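/- arXiv:1310.8090 — 3 statements merged into one kernel-verified Lean document; each statement's English description precedes it below -/
import Mathlib

section
/- (Brouwer fixed-point theorem for the cube) Every continuous map g : [0,1]^n → [0,1]^n has a fixed point, i.e. there exists x ∈ [0,1]^n with g(x) = x. -/
/-- For a family `u` of utility functions, a finite set `T` is dominant if every element `x` is,
for some index `i`, at most as good as every member of `T`. -/
def IsDominant {I V : Type*} (u : I → V → ℕ) (T : Finset V) : Prop :=
  ∀ x, ∃ i, ∀ t ∈ T, u i x ≤ u i t

/-- `a l` is a `u l`-minimal element of `T` for every index `l`. -/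
def IsArgmin {I V : Type*} (u : I → V → ℕ) (T : Finset V) (a : I → V) : Prop :=
  ∀ l, a l ∈ T ∧ ∀ t ∈ T, u l (a l) ≤ u l t

section Scarf

open Finset

variable {I V : Type*}

theorem IsDominant.mono {u : I → V → ℕ} {S T : Finset V} (hT : IsDominant u T) (h : S ⊆ T) :
    IsDominant u S := fun x => by
  obtain ⟨i, hi⟩ := hT x
  exact ⟨i, fun t ht => hi t (h ht)⟩

theorem exists_isArgmin {u : I → V → ℕ} {T : Finset V} (hT : T.Nonempty) :
    ∃ a, IsArgmin u T a := by
  choose a ha using fun l => T.exists_min_image (u l) hT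
  exact ⟨a, ha⟩

theorem IsArgmin.exists_le {u : I → V → ℕ} {T : Finset V} {a : I → V}
    (ha : IsArgmin u T a) (hT : IsDominant u T) (x : V) : ∃ l, u l x ≤ u l (a l) := by
  obtain ⟨l, hl⟩ := hT x
  exact ⟨l, hl _ (ha l).1⟩

theorem IsArgmin.exists_eq {u : I → V → ℕ} (hu : ∀ i, Function.Injective (u i))
    {T : Finset V} {a : I → V} (ha : IsArgmin u T a) (hT : IsDominant u T) {t : V} (ht : t ∈ T) :
    ∃ l, a l = t := by
  obtain ⟨l, hl⟩ := ha.exists_le hT t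
  exact ⟨l, hu l (le_antisymm ((ha l).2 t ht) hl)⟩

/-- For a nonempty set with one element fewer than there are indices, two indices share their
minimal element. -/
theorem IsArgmin.exists_collision [Fintype I] {u : I → V → ℕ} {T : Finset V} {a : I → V}
    (ha : IsArgmin u T a) (hc : T.card + 1 = Fintype.card I) : ∃ i j, i ≠ j ∧ a i = a j := by
  obtain ⟨i, -, j, -, hij, h⟩ := Finset.exists_ne_map_eq_of_card_lt_of_maps_to
    (s := (univ : Finset I)) (t := T) (f := a) (by rw [card_univ]; omega) (fun l _ => (ha l).1)
  exact ⟨i, j, hij, h⟩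

variable [Fintype I] [DecidableEq I]

/-- The elements strictly above the minimal elements `a l`, for all indices `l ≠ k`. -/
def beyond [Fintype V] (u : I → V → ℕ) (a : I → V) (k : I) : Finset V :=
  {x | ∀ l, l ≠ k → u l (a l) < u l x}

/-- The `u k`-maximal elements of `beyond u a k`. -/
def beyondMax [Fintype V] (u : I → V → ℕ) (a : I → V) (k : I) : Finset V :=
  {v ∈ beyond u a k | ∀ x ∈ beyond u a k, u k x ≤ u k v}

theorem mem_beyond [Fintype V] {u : I → V → ℕ} {a : I → V} {k : I} {x : V} :
    x ∈ beyond u a k ↔ ∀ l, l ≠ k → u l (a l) < u l x := by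
  simp [beyond]

theorem mem_beyondMax [Fintype V] {u : I → V → ℕ} {a : I → V} {k : I} {v : V} :
    v ∈ beyondMax u a k ↔ v ∈ beyond u a k ∧ ∀ x ∈ beyond u a k, u k x ≤ u k v := by
  simp [beyondMax]

theorem card_beyondMax [Fintype V] {u : I → V → ℕ} (hu : ∀ i, Function.Injective (u i)) (a : I → V) (k : I) :
    (beyondMax u a k).card = if (beyond u a k).Nonempty then 1 else 0 := by
  split_ifs with h
  · obtain ⟨v, hv, hmax⟩ := (beyond u a k).exists_max_image (u k) h
    rw [card_eq_one]
    refine ⟨v, ?_⟩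
    ext w
    rw [mem_beyondMax, mem_singleton]
    constructor
    · rintro ⟨hw, hw'⟩
      exact hu k (le_antisymm (hmax w hw) (hw' v hv))
    · rintro rfl
      exact ⟨hv, hmax⟩
  · rw [card_eq_zero, beyondMax, not_nonempty_iff_eq_empty.1 h, filter_empty]

theorem IsArgmin.notMem_of_mem_beyond [Fintype V] {u : I → V → ℕ}
    (hu : ∀ i, Function.Injective (u i)) {T : Finset V} {a : I → V} (ha : IsArgmin u T a) (hT : IsDominant u T)
    {i j : I} (hij : i ≠ j) (h : a i = a j) {v : V} (hv : v ∈ beyond u a i) : v ∉ T := by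
  intro hvT
  rw [mem_beyond] at hv
  obtain ⟨l, rfl⟩ := ha.exists_eq hu hT hvT
  by_cases hl : l = i
  · subst hl
    have := hv j hij.symm
    rw [h] at this
    exact lt_irrefl _ this
  · exact lt_irrefl _ (hv l hl)

variable [DecidableEq V]

/-- For a dominant set with one element fewer than there are indices, only one pair of indices
shares its minimal element. -/
theorem IsArgmin.eq_or_eq {u : I → V → ℕ} (hu : ∀ i, Function.Injective (u i))
    {T : Finset V} {a : I → V} (ha : IsArgmin u T a) (hT : IsDominant u T)
    (hc : T.card + 1 = Fintype.card I) {i j k l : I} (hij : i ≠ j) (h : a i = a j)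
    (hkl : k ≠ l) (h' : a k = a l) : k = i ∨ k = j := by
  have key : (univ.erase i).image a = T := by
    ext t
    simp only [mem_image, mem_erase, mem_univ, and_true]
    constructor
    · rintro ⟨l, -, rfl⟩
      exact (ha l).1
    · intro ht
      obtain ⟨l, rfl⟩ := ha.exists_eq hu hT ht
      by_cases hl : l = i
      · exact ⟨j, hij.symm, by rw [hl, h]⟩
      · exact ⟨l, hl, rfl⟩
  have inj : Set.InjOn a (univ.erase i : Finset I) := by
    rw [← card_image_iff, key, card_erase_of_mem (mem_univ _), card_univ]
    omega
  by_contra! hk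
  by_cases hl : l = i
  · exact hk.2 (inj (by simp [hk.1]) (by simp [hij.symm]) (by rw [h', hl, h]))
  · exact hkl (inj (by simp [hk.1]) (by simp [hl]) h')

/-- A set of `|I|` coloured points missing a colour has an even number of facets whose
colours are exactly those different from `i₀`. -/
theorem even_card_facets (c : V → I) (i₀ : I) {S : Finset V} (hS : S.card = Fintype.card I)
    (hc : S.image c ≠ univ) : Even #{v ∈ S | (S.erase v).image c = univ.erase i₀} := by
  rcases eq_empty_or_nonempty {v ∈ S | (S.erase v).image c = univ.erase i₀} with h | ⟨v, hv⟩
  · simp [h]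
  rw [mem_filter] at hv
  obtain ⟨hvS, hv⟩ := hv
  have inj : ∀ w ∈ S, (S.erase w).image c = univ.erase i₀ → Set.InjOn c (S.erase w) := by
    intro w hw h
    rw [← card_image_iff, h, card_erase_of_mem (mem_univ _), card_erase_of_mem hw, hS, card_univ]
  have hcv : c v ≠ i₀ := by
    intro h
    apply hc
    rw [← insert_erase hvS, image_insert, hv, h, insert_erase (mem_univ _)]
  have : c v ∈ (S.erase v).image c := by rw [hv]; simp [hcv]
  obtain ⟨w, hw, hwv⟩ := mem_image.1 this
  rw [mem_erase] at hw
  have heq : {v ∈ S | (S.erase v).image c = univ.erase i₀} = {v, w} := by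
    ext x
    simp only [mem_filter, mem_insert, mem_singleton]
    constructor
    · rintro ⟨hx, hx'⟩
      by_contra! hne
      exact hw.1 (inj x hx hx' (by simp [hw.2, hne.2.symm]) (by simp [hvS, hne.1.symm]) hwv)
    · rintro (rfl | rfl)
      · exact ⟨hvS, hv⟩
      · refine ⟨hw.2, ?_⟩
        rw [← hv, ← insert_erase (mem_erase.2 ⟨hw.1.symm, hvS⟩ : v ∈ S.erase x),
          ← insert_erase (mem_erase.2 ⟨hw.1, hw.2⟩ : x ∈ S.erase v), image_insert, image_insert,
          hwv, erase_right_comm]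
  rw [heq, card_pair hw.1.symm]
  exact even_two

theorem isDominant_image_slack {u : I → V → ℕ} {s : I → V} (hmin : ∀ i v, u i (s i) ≤ u i v)
    (hmax : ∀ i j v, j ≠ i → v ∉ Set.range s → u i v < u i (s j)) (i₀ : I) :
    IsDominant u ((univ.erase i₀).image s) := by
  intro x
  by_cases hx : x ∈ Set.range s
  · obtain ⟨i, rfl⟩ := hx
    exact ⟨i, fun t _ => hmin i t⟩
  · refine ⟨i₀, fun t ht => ?_⟩
    simp only [mem_image, mem_erase, mem_univ, and_true] at ht
    obtain ⟨j, hj, rfl⟩ := ht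
    exact (hmax i₀ j x hj hx).le

variable [Fintype V]

theorem IsArgmin.isDominant_insert {u : I → V → ℕ} {T : Finset V} {a : I → V}
    (ha : IsArgmin u T a) (hT : IsDominant u T) {k : I} {v : V} (hv : v ∈ beyondMax u a k) :
    IsDominant u (insert v T) := by
  rw [mem_beyondMax, mem_beyond] at hv
  intro z
  by_cases hz : z ∈ beyond u a k
  · refine ⟨k, ?_⟩
    obtain ⟨l, hl⟩ := ha.exists_le hT z
    obtain rfl : l = k := by
      by_contra hlk
      exact absurd (mem_beyond.1 hz l hlk) (by omega)
    rw [forall_mem_insert]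
    exact ⟨hv.2 z hz, fun t ht => hl.trans ((ha l).2 t ht)⟩
  · rw [mem_beyond] at hz
    push Not at hz
    obtain ⟨l, hlk, hl⟩ := hz
    refine ⟨l, ?_⟩
    rw [forall_mem_insert]
    exact ⟨hl.trans (hv.1 l hlk).le, fun t ht => hl.trans ((ha l).2 t ht)⟩

theorem IsArgmin.mem_beyondMax_of_insert {u : I → V → ℕ} (hu : ∀ i, Function.Injective (u i))
    {T : Finset V} {a : I → V} (ha : IsArgmin u T a)
    (hc : T.card + 1 = Fintype.card I) {v : V} (hvT : v ∉ T)
    (hv : IsDominant u (insert v T)) :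
    ∃ k, v ∈ beyondMax u a k ∧ ∃ l, k ≠ l ∧ a k = a l := by
  obtain ⟨k, hk⟩ := hv v
  have hkT : ∀ t ∈ T, u k v < u k t := fun t ht =>
    lt_of_le_of_ne (hk t (mem_insert_of_mem ht)) fun h => hvT (hu k h ▸ ht)
  have surj : ∀ t ∈ T, ∃ l, a l = t ∧ u l t < u l v := by
    intro t ht
    obtain ⟨l, hl⟩ := hv t
    rw [forall_mem_insert] at hl
    refine ⟨l, hu l (le_antisymm ((ha l).2 t ht) (hl.2 _ (ha l).1)), ?_⟩
    exact lt_of_le_of_ne hl.1 fun h => hvT (hu l h ▸ ht)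
  have hmem : v ∈ beyond u a k := by
    rw [mem_beyond]
    by_contra! hcon
    obtain ⟨l, hlk, hl⟩ := hcon
    have hsub : T ⊆ ((univ.erase k).erase l).image a := by
      intro t ht
      obtain ⟨p, hp, hpv⟩ := surj t ht
      refine mem_image.2 ⟨p, ?_, hp⟩
      simp only [mem_erase, mem_univ, and_true]
      constructor
      · rintro rfl
        rw [hp] at hl
        omega
      · rintro rfl
        have := hkT t ht
        omega
    have h1 := (card_le_card hsub).trans card_image_le
    rw [card_erase_of_mem (by simp [hlk]), card_erase_of_mem (mem_univ _), card_univ] at h1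
    have : 1 < Fintype.card I := Fintype.one_lt_card_iff.2 ⟨l, k, hlk⟩
    omega
  refine ⟨k, mem_beyondMax.2 ⟨hmem, ?_⟩, ?_⟩
  · intro x hx
    obtain ⟨l, hl⟩ := hv x
    rw [forall_mem_insert] at hl
    obtain rfl : l = k := by
      by_contra hlk
      have := mem_beyond.1 hx l hlk
      have := hl.2 _ (ha l).1
      omega
    exact hl.1
  · obtain ⟨l, hl, hlv⟩ := surj (a k) (ha k).1
    refine ⟨l, ?_, hl.symm⟩
    rintro rfl
    have := hkT _ (ha k).1
    omega

open Classical in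
theorem IsArgmin.card_insert {u : I → V → ℕ} (hu : ∀ i, Function.Injective (u i))
    {T : Finset V} {a : I → V} (ha : IsArgmin u T a) (hT : IsDominant u T)
    (hc : T.card + 1 = Fintype.card I) {i j : I} (hij : i ≠ j) (h : a i = a j) :
    #{v | v ∉ T ∧ IsDominant u (insert v T)} =
      (if (beyond u a i).Nonempty then 1 else 0) + if (beyond u a j).Nonempty then 1 else 0 := by
  rw [← card_beyondMax hu, ← card_beyondMax hu, ← card_union_of_disjoint]
  · congr 1
    ext v
    simp only [mem_filter, mem_univ, true_and, mem_union]
    constructor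
    · rintro ⟨hvT, hv⟩
      obtain ⟨k, hk, l, hkl, hl⟩ := ha.mem_beyondMax_of_insert hu hc hvT hv
      rcases ha.eq_or_eq hu hT hc hij h hkl hl with rfl | rfl
      · exact Or.inl hk
      · exact Or.inr hk
    · rintro (hv | hv)
      · exact ⟨ha.notMem_of_mem_beyond hu hT hij h (mem_beyondMax.1 hv).1,
          ha.isDominant_insert hT hv⟩
      · exact ⟨ha.notMem_of_mem_beyond hu hT hij.symm h.symm (mem_beyondMax.1 hv).1,
          ha.isDominant_insert hT hv⟩
  · rw [Finset.disjoint_left]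
    intro v hi hj
    rw [mem_beyondMax, mem_beyond] at hi hj
    obtain ⟨l, hl⟩ := ha.exists_le hT v
    by_cases hli : l = i
    · have := hj.1 l (hli ▸ hij)
      omega
    · have := hi.1 l hli
      omega

theorem card_superset_eq_card_insert (p : Finset V → Prop) [DecidablePred p] (T : Finset V) :
    #{S | (S.card = T.card + 1 ∧ p S) ∧ T ⊆ S} = #{v | v ∉ T ∧ p (insert v T)} := by
  symm
  refine card_bij (fun v _ => insert v T) ?_ ?_ ?_
  · intro v hv
    simp only [mem_filter, mem_univ, true_and] at hv ⊢
    exact ⟨⟨card_insert_of_notMem hv.1, hv.2⟩, subset_insert _ _⟩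
  · intro v hv w hw hvw
    simp only [mem_filter, mem_univ, true_and] at hv hw
    have : v ∈ insert w T := hvw ▸ mem_insert_self v T
    exact (mem_insert.1 this).resolve_right hv.1
  · intro S hS
    simp only [mem_filter, mem_univ, true_and] at hS
    obtain ⟨⟨h1, h2⟩, h3⟩ := hS
    obtain ⟨v, hv, rfl⟩ := (covBy_iff_card_sdiff_eq_one.2
      ⟨h3, by rw [card_sdiff_of_subset h3]; omega⟩ : T ⋖ S).exists_finset_insert
    exact ⟨v, by simp [hv, h2], rfl⟩

theorem card_subset_eq_card_facets (p : Finset V → Prop) [DecidablePred p] (S : Finset V) :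
    #{T | (T.card + 1 = S.card ∧ p T) ∧ T ⊆ S} = #{v ∈ S | p (S.erase v)} := by
  symm
  refine card_bij (fun v _ => S.erase v) ?_ ?_ ?_
  · intro v hv
    simp only [mem_filter, mem_univ, true_and] at hv ⊢
    exact ⟨⟨card_erase_add_one hv.1, hv.2⟩, erase_subset _ _⟩
  · intro v hv w hw hvw
    simp only [mem_filter] at hv hw
    exact erase_injOn S hv.1 hw.1 hvw
  · intro T hT
    simp only [mem_filter, mem_univ, true_and] at hT
    obtain ⟨⟨h1, h2⟩, h3⟩ := hT
    obtain ⟨v, hv, rfl⟩ := (covBy_iff_card_sdiff_eq_one.2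
      ⟨h3, by rw [card_sdiff_of_subset h3]; omega⟩ : T ⋖ S).exists_finset_insert
    exact ⟨v, by simp [hv, h2], by simp [hv]⟩

section Slack

variable {u : I → V → ℕ} {s : I → V} {c : V → I}

open Classical in
/-- A dominant set with one element fewer than there are indices that contains a non-slack
element lies in exactly two dominant sets with one more element. -/
theorem card_insert_of_notMem_range (hu : ∀ i, Function.Injective (u i))
    (hmax : ∀ i j v, j ≠ i → v ∉ Set.range s → u i v < u i (s j)) {T : Finset V}
    (hT : IsDominant u T) (hcard : T.card + 1 = Fintype.card I) {t : V} (ht : t ∈ T) (hts : t ∉ Set.range s) :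
    #{v | v ∉ T ∧ IsDominant u (insert v T)} = 2 := by
  obtain ⟨a, ha⟩ := exists_isArgmin (u := u) ⟨t, ht⟩
  obtain ⟨i, j, hij, h⟩ := ha.exists_collision hcard
  have hlt : ∀ k l, l ≠ k → u l (a l) < u l (s k) := fun k l hlk =>
    ((ha l).2 t ht).trans_lt (hmax l k t hlk.symm hts)
  have hne : ∀ k, (beyond u a k).Nonempty := fun k => ⟨s k, mem_beyond.2 (hlt k)⟩
  rw [ha.card_insert hu hT hcard hij h, if_pos (hne i), if_pos (hne j)]

open Classical in
theorem card_insert_image_slack [Nontrivial I] (hu : ∀ i, Function.Injective (u i))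
    (hs : Function.Injective s) (hmin : ∀ i v, u i (s i) ≤ u i v)
    (hmax : ∀ i j v, j ≠ i → v ∉ Set.range s → u i v < u i (s j)) (i₀ : I) :
    #{v | v ∉ (univ.erase i₀).image s ∧ IsDominant u (insert v ((univ.erase i₀).image s))} = 1 := by
  have hT := isDominant_image_slack hmin hmax i₀
  have hcard : ((univ.erase i₀).image s).card + 1 = Fintype.card I := by
    rw [card_image_of_injective _ hs, card_erase_add_one (mem_univ _), card_univ]
  obtain ⟨p, hp⟩ := exists_ne i₀
  obtain ⟨a, ha⟩ := exists_isArgmin (u := u) (T := (univ.erase i₀).image s)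
    ⟨s p, mem_image_of_mem s (by simp [hp])⟩
  have has : ∀ l, l ≠ i₀ → a l = s l := fun l hl =>
    hu l (le_antisymm ((ha l).2 _ (mem_image_of_mem s (by simp [hl]))) (hmin l _))
  obtain ⟨j, hj, h⟩ : ∃ j, i₀ ≠ j ∧ a i₀ = a j := by
    obtain ⟨i, j, hij, h⟩ := ha.exists_collision hcard
    by_cases hi : i = i₀
    · exact ⟨j, hi ▸ hij, hi ▸ h⟩
    · by_cases hj : j = i₀
      · exact ⟨i, hj ▸ hij.symm, hj ▸ h.symm⟩
      · rw [has i hi, has j hj] at h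
        exact absurd (hs h) hij
  have h1 : (beyond u a i₀).Nonempty := by
    refine ⟨s i₀, mem_beyond.2 fun l hl => ?_⟩
    rw [has l hl]
    exact lt_of_le_of_ne (hmin l _) fun h => hl (hs (hu l h))
  have h2 : ¬ (beyond u a j).Nonempty := by
    rintro ⟨x, hx⟩
    rw [mem_beyond] at hx
    have h0 := hx i₀ hj
    rw [h, has j hj.symm] at h0
    have hxs : x ∈ Set.range s := by
      by_contra hxs
      have := hmax i₀ j x hj.symm hxs
      omega
    obtain ⟨q, rfl⟩ := hxs
    by_cases hq : q = j
    · subst hq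
      exact lt_irrefl _ h0
    · have := hx q hq
      have := hmin q (a q)
      omega
  rw [ha.card_insert hu hT hcard hj h, if_pos h1, if_neg h2]

/-- **Scarf's lemma**: for every colouring there is a dominant set that meets all colours. -/
theorem exists_isDominant_image_eq_univ [Nontrivial I] (hu : ∀ i, Function.Injective (u i))
    (hmin : ∀ i v, u i (s i) ≤ u i v)
    (hmax : ∀ i j v, j ≠ i → v ∉ Set.range s → u i v < u i (s j)) (hcs : ∀ i, c (s i) = i) :
    ∃ T, IsDominant u T ∧ T.image c = univ := by
  classical
  have hs : Function.Injective s := Function.LeftInverse.injective hcs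
  by_contra! hno
  obtain ⟨i₀⟩ := (inferInstance : Nonempty I)
  set R : Finset (Finset V) := {S | S.card = Fintype.card I ∧ IsDominant u S} with hR
  set D : Finset (Finset V) :=
    {T | T.card + 1 = Fintype.card I ∧ IsDominant u T ∧ T.image c = univ.erase i₀} with hD
  have hsum := sum_card_bipartiteAbove_eq_sum_card_bipartiteBelow
    (s := D) (t := R) (fun T S : Finset V => T ⊆ S)
  have hright : Even (∑ S ∈ R, #(D.bipartiteBelow (fun T S : Finset V => T ⊆ S) S)) := by
    refine Finset.even_sum _ fun S hS => ?_
    simp only [hR, mem_filter, mem_univ, true_and] at hS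
    have h1 := even_card_facets c i₀ hS.1 (hno S hS.2)
    rw [← card_subset_eq_card_facets (fun T => T.image c = univ.erase i₀)] at h1
    refine (congrArg (fun s : Finset (Finset V) => Even #s) (Finset.ext fun T => ?_)).mpr h1
    simp only [mem_bipartiteBelow, hD, mem_filter, mem_univ, true_and, hS.1]
    exact ⟨fun h => ⟨⟨h.1.1, h.1.2.2⟩, h.2⟩,
      fun h => ⟨⟨h.1.1, hS.2.mono h.2, h.1.2⟩, h.2⟩⟩
  have habove : ∀ T ∈ D, #(R.bipartiteAbove (fun T S : Finset V => T ⊆ S) T) =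
      #{v | v ∉ T ∧ IsDominant u (insert v T)} := by
    intro T hT
    rw [← card_superset_eq_card_insert]
    simp only [hD, mem_filter, mem_univ, true_and] at hT
    refine congrArg card (Finset.ext fun S => ?_)
    simp [mem_bipartiteAbove, hR, hT.1]
  set T₀ := (univ.erase i₀).image s with hT₀
  have hT₀D : T₀ ∈ D := by
    simp only [hD, mem_filter, mem_univ, true_and]
    refine ⟨?_, isDominant_image_slack hmin hmax i₀, ?_⟩
    · rw [card_image_of_injective _ hs, card_erase_add_one (mem_univ _), card_univ]
    · rw [hT₀, image_image, show c ∘ s = id from funext hcs, image_id]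
  have hleft : Odd (∑ T ∈ D, #(R.bipartiteAbove (fun T S : Finset V => T ⊆ S) T)) := by
    rw [← add_sum_erase _ _ hT₀D, habove _ hT₀D, card_insert_image_slack hu hs hmin hmax]
    refine odd_one.add_even (Finset.even_sum _ fun T hT => ?_)
    rw [mem_erase] at hT
    rw [habove T hT.2]
    simp only [hD, mem_filter, mem_univ, true_and] at hT
    obtain ⟨hne, hcard, hdom, himg⟩ := hT
    obtain ⟨t, ht, hts⟩ : ∃ t ∈ T, t ∉ Set.range s := by
      by_contra! hall
      apply hne
      refine eq_of_subset_of_card_le (fun t ht => ?_) ?_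
      · obtain ⟨i, rfl⟩ := hall t ht
        have : c (s i) ∈ univ.erase i₀ := himg ▸ mem_image_of_mem c ht
        rw [hcs] at this
        exact mem_image_of_mem s this
      · rw [hT₀, card_image_of_injective _ hs, card_erase_of_mem (mem_univ _), card_univ]
        omega
    rw [card_insert_of_notMem_range hu hmax hdom hcard ht hts]
    exact even_two
  rw [hsum] at hleft
  exact Nat.not_even_iff_odd.2 hleft hright

end Slack

end Scarf

section Grid

open Finset

variable {I : Type*} [Fintype I] [DecidableEq I]

/-- For every colouring of the points of the grid `{v ∈ ℕ^I | ∑ v = N}` and every index `i`,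
one can choose a grid point that has colour `i` or a small `i`-th coordinate,
such that the chosen points are close to each other. -/
theorem exists_close_grid_points [Nontrivial I] (N : ℕ) (c : (I → ℕ) → I) :
    ∃ y : I → I → ℕ, (∀ i, ∑ k, y i k = N) ∧
      (∀ i j k, y i k ≤ y j k + Fintype.card I) ∧
      ∀ i, c (y i) = i ∨ y i i ≤ Fintype.card I := by
  let X := {v : I → ℕ // v ∈ piAntidiag (univ : Finset I) N}
  have hX : ∀ x : X, ∑ k, x.1 k = N := fun x => (mem_piAntidiag.1 x.2).1
  let x₀ : X := ⟨Pi.single (Classical.arbitrary I) N, by simp [mem_piAntidiag]⟩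
  set K := Fintype.card X with hK
  let e : X ≃ Fin K := Fintype.equivFin X
  let e' : I ≃ Fin (Fintype.card I) := Fintype.equivFin I
  let u : I → X ⊕ I → ℕ := fun i => Sum.elim (fun x => x.1 i * K + e x + 1)
    (fun j => if j = i then 0 else N * K + K + 1 + e' j)
  have hle : ∀ (x : X) i, x.1 i ≤ N := fun x i =>
    (single_le_sum (f := x.1) (fun _ _ => Nat.zero_le _) (mem_univ i)).trans_eq (hX x)
  have hltX : ∀ i (x : X), u i (Sum.inl x) < N * K + K + 1 := by
    intro i x
    have h1 := Nat.mul_le_mul_right K (hle x i)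
    have h2 := (e x).2
    simp only [u, Sum.elim_inl]
    omega
  have hmono : ∀ i (x y : X), x.1 i < y.1 i → u i (Sum.inl x) < u i (Sum.inl y) := by
    intro i x y h
    have h1 := Nat.mul_le_mul_right K (Nat.succ_le_of_lt h)
    have h2 := (e x).2
    simp only [u, Sum.elim_inl]
    rw [Nat.succ_mul] at h1
    omega
  have hu : ∀ i, Function.Injective (u i) := by
    rintro i (x | j) (y | k) h
    · rcases lt_trichotomy (x.1 i) (y.1 i) with hxy | hxy | hxy
      · exact absurd h (hmono i x y hxy).ne
      · simp only [u, Sum.elim_inl, hxy] at h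
        exact congrArg Sum.inl (e.injective (Fin.ext (by omega)))
      · exact absurd h (hmono i y x hxy).ne'
    · have := hltX i x
      rw [h] at this
      simp only [u, Sum.elim_inl, Sum.elim_inr] at h this
      split_ifs at h this
      all_goals omega
    · have := hltX i y
      rw [← h] at this
      simp only [u, Sum.elim_inl, Sum.elim_inr] at h this
      split_ifs at h this
      all_goals omega
    · simp only [u, Sum.elim_inr] at h
      split_ifs at h with h1 h2 h2
      · rw [h1, h2]
      · omega
      · omega
      · exact congrArg Sum.inr (e'.injective (Fin.ext (by omega)))
  obtain ⟨T, hT, hcT⟩ := exists_isDominant_image_eq_univ (u := u) (s := Sum.inr)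
    (c := Sum.elim (fun x => c x.1) id) hu (by simp [u])
    (by
      rintro i j (x | k) hji hv
      · have := hltX i x
        simp only [u, Sum.elim_inr, if_neg hji] at this ⊢
        omega
      · exact absurd ⟨k, rfl⟩ hv)
    (fun _ => rfl)
  have hmemC : ∀ (x : X) i, (∀ t ∈ T, u i (Sum.inl x) ≤ u i t) → Sum.inr i ∉ T := by
    intro x i h hi
    have := h _ hi
    simp [u] at this
  have hcol : ∀ i, Sum.inr i ∉ T → ∃ y : X, Sum.inl y ∈ T ∧ c y.1 = i := by
    intro i hi
    have : i ∈ T.image (Sum.elim (fun x : X => c x.1) id) := by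
      rw [hcT]
      exact mem_univ i
    obtain ⟨y | k, hy, h⟩ := mem_image.1 this
    · exact ⟨y, hy, h⟩
    · simp only [Sum.elim_inr, id] at h
      exact absurd (h ▸ hy) hi
  obtain ⟨i₀, hi₀⟩ : ∃ i₀, Sum.inr i₀ ∉ T := by
    obtain ⟨i, hi⟩ := hT (Sum.inl x₀)
    exact ⟨i, hmemC x₀ i hi⟩
  obtain ⟨y₀, hy₀, -⟩ := hcol i₀ hi₀
  obtain ⟨m, hm⟩ : ∃ m : I → ℕ, ∀ i, (∃ y : X, Sum.inl y ∈ T ∧ y.1 i = m i) ∧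
      ∀ y : X, Sum.inl y ∈ T → m i ≤ y.1 i := by
    have : ∀ i, ∃ y : X, Sum.inl y ∈ T ∧ ∀ z : X, Sum.inl z ∈ T → y.1 i ≤ z.1 i := by
      intro i
      obtain ⟨y, hy, hmin⟩ := ({y : X | Sum.inl y ∈ T} : Finset X).exists_min_image
        (fun y => y.1 i) ⟨y₀, by simpa using hy₀⟩
      exact ⟨y, by simpa using hy, fun z hz => hmin z (by simpa using hz)⟩
    choose y hy using this
    exact ⟨fun i => (y i).1 i, fun i => ⟨⟨y i, (hy i).1, rfl⟩, (hy i).2⟩⟩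
  set C : Finset I := {i | Sum.inr i ∉ T} with hC
  have hsum : N < ∑ i ∈ C, (m i + 1) := by
    by_contra! hcon
    let w : I → ℕ := fun i => (if i ∈ C then m i + 1 else 0) +
      Pi.single (M := fun _ => ℕ) i₀ (N - ∑ i ∈ C, (m i + 1)) i
    have hw : ∑ i, w i = N := by
      simp only [w, sum_add_distrib, sum_ite_mem, univ_inter]
      rw [← sum_add_distrib, Finset.sum_pi_single']
      simp
      rw [sum_add_distrib] at hcon ⊢
      simp at hcon ⊢
      omega
    let x : X := ⟨w, by simp [mem_piAntidiag, hw]⟩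
    obtain ⟨i, hi⟩ := hT (Sum.inl x)
    have hiC : i ∈ C := by simpa [hC] using hmemC x i hi
    obtain ⟨y, hy, hym⟩ := (hm i).1
    have h1 : y.1 i < x.1 i := by
      simp only [x, w, if_pos hiC, hym]
      omega
    exact absurd (hi _ hy) (not_le.2 (hmono i y x h1))
  have hcardC : C.card ≤ Fintype.card I := card_le_univ C
  rw [sum_add_distrib, sum_const, smul_eq_mul, mul_one] at hsum
  have hbound : ∀ y : X, Sum.inl y ∈ T → ∀ k,
      y.1 k ≤ (if k ∈ C then m k else 0) + Fintype.card I := by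
    intro y hy k
    have h1 : ∑ i, ((y.1 i : ℤ) - if i ∈ C then m i else 0) ≤ Fintype.card I := by
      have h2 := hX y
      have h3 : ∑ i, (if i ∈ C then m i else 0) = ∑ i ∈ C, m i := by
        simp [sum_ite_mem]
      rw [sum_sub_distrib]
      zify at h2 h3 hsum hcardC
      push_cast at h3 ⊢
      rw [h2, h3]
      omega
    have h4 : ((y.1 k : ℤ) - if k ∈ C then m k else 0) ≤
        ∑ i, ((y.1 i : ℤ) - if i ∈ C then m i else 0) := by
      refine single_le_sum (f := fun i => ((y.1 i : ℤ) - if i ∈ C then m i else 0))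
        (fun i _ => ?_) (mem_univ k)
      have := (hm i).2 y hy
      split_ifs <;> omega
    split_ifs at h4 ⊢ <;> omega
  have hlow : ∀ y : X, Sum.inl y ∈ T → ∀ k, (if k ∈ C then m k else 0) ≤ y.1 k := by
    intro y hy k
    split_ifs
    · exact (hm k).2 y hy
    · exact Nat.zero_le _
  have hy : ∀ i, ∃ y : X, Sum.inl y ∈ T ∧ (c y.1 = i ∨ y.1 i ≤ Fintype.card I) := by
    intro i
    by_cases hi : Sum.inr i ∈ T
    · refine ⟨y₀, hy₀, Or.inr ?_⟩
      have := hbound y₀ hy₀ i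
      rw [if_neg (by simpa [hC] using hi)] at this
      omega
    · obtain ⟨y, hy, h⟩ := hcol i hi
      exact ⟨y, hy, Or.inl h⟩
  choose y hyT hyc using hy
  refine ⟨fun i => (y i).1, fun i => hX _, fun i j k => ?_, hyc⟩
  have h1 := hbound (y i) (hyT i) k
  have h2 := hlow (y j) (hyT j) k
  exact h1.trans (Nat.add_le_add_right h2 _)

end Grid

section Simplex

open Finset

variable {I : Type*} [Fintype I]

theorem exists_le_of_sum_eq [Nonempty I] {x y : I → ℝ} (h : ∑ i, x i = ∑ i, y i) :
    ∃ i, x i ≤ y i := by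
  obtain ⟨i, -, hi⟩ := exists_le_of_sum_le (s := univ) univ_nonempty h.le
  exact ⟨i, hi⟩

theorem exists_close_simplex_points [Nontrivial I] (f : stdSimplex ℝ I → stdSimplex ℝ I)
    {ε : ℝ} (hε : 0 < ε) :
    ∃ y : I → stdSimplex ℝ I, (∀ i j, dist (y i) (y j) ≤ ε) ∧
      ∀ i, (y i).1 i ≤ (f (y i)).1 i + ε := by
  classical
  obtain ⟨N, hN⟩ := exists_nat_gt ((Fintype.card I : ℝ) / ε)
  have hN0 : (0 : ℝ) < N := lt_of_le_of_lt (by positivity) hN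
  have hNε : (Fintype.card I : ℝ) / N ≤ ε := by
    rw [div_lt_iff₀ hε] at hN
    rw [div_le_iff₀ hN0]
    linarith
  let p : (I → ℕ) → I → ℝ := fun v i => v i / N
  have hp : ∀ v : I → ℕ, ∑ i, v i = N → p v ∈ stdSimplex ℝ I := by
    intro v hv
    refine ⟨fun i => by positivity, ?_⟩
    rw [← sum_div, ← Nat.cast_sum, hv, div_self hN0.ne']
  have hcol : ∀ v : I → ℕ, ∃ i, ∀ hv : ∑ i, v i = N, p v i ≤ (f ⟨p v, hp v hv⟩).1 i := by
    intro v
    by_cases hv : ∑ i, v i = N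
    · obtain ⟨i, hi⟩ := exists_le_of_sum_eq (x := p v) (y := (f ⟨p v, hp v hv⟩).1)
        ((hp v hv).2.trans (f ⟨p v, hp v hv⟩).2.2.symm)
      exact ⟨i, fun _ => hi⟩
    · exact ⟨Classical.arbitrary I, fun h => absurd h hv⟩
  choose c hc using hcol
  obtain ⟨y, hy, hclose, hcy⟩ := exists_close_grid_points N c
  have hdiff : ∀ i j k, p (y i) k - p (y j) k ≤ ε := by
    intro i j k
    refine le_trans ?_ hNε
    rw [← sub_div]
    gcongr
    have : (y i k : ℝ) ≤ y j k + Fintype.card I := by exact_mod_cast hclose i j k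
    linarith
  refine ⟨fun i => ⟨p (y i), hp _ (hy i)⟩, fun i j => ?_, fun i => ?_⟩
  · rw [Subtype.dist_eq, dist_pi_le_iff hε.le]
    intro k
    rw [Real.dist_eq, abs_sub_le_iff]
    exact ⟨hdiff i j k, hdiff j i k⟩
  · have hnonneg := (f ⟨p (y i), hp _ (hy i)⟩).2.1 i
    rcases hcy i with h | h
    · have := hc (y i) (hy i)
      rw [h] at this
      exact this.trans (by linarith)
    · have : p (y i) i ≤ ε := by
        refine le_trans ?_ hNε
        simp only [p]
        gcongr
      exact this.trans (by linarith)

/-- **Brouwer fixed-point theorem for the standard simplex.** -/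
theorem exists_fixedPoint_stdSimplex [Nontrivial I] {f : stdSimplex ℝ I → stdSimplex ℝ I}
    (hf : Continuous f) : ∃ x, f x = x := by
  obtain ⟨i₀⟩ := (inferInstance : Nonempty I)
  have : CompactSpace (stdSimplex ℝ I) := isCompact_iff_compactSpace.1 (isCompact_stdSimplex ℝ I)
  have hlim : ∀ n : ℕ, (0 : ℝ) < 1 / (n + 1) := fun n => by positivity
  choose y hy hyf using fun n => exists_close_simplex_points f (hlim n)
  obtain ⟨x, -, φ, hφ, hx⟩ := isCompact_univ.tendsto_subseq (fun n => Set.mem_univ (y n i₀))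
  have hε : Filter.Tendsto (fun n => (1 : ℝ) / ((φ n : ℝ) + 1)) Filter.atTop (nhds 0) :=
    tendsto_one_div_add_atTop_nhds_zero_nat.comp hφ.tendsto_atTop
  have hx' : ∀ i, Filter.Tendsto (fun n => y (φ n) i) Filter.atTop (nhds x) := by
    intro i
    refine hx.congr_dist ?_
    exact squeeze_zero (fun _ => dist_nonneg) (fun n => hy (φ n) i₀ i) hε
  have hle : ∀ i, x.1 i ≤ (f x).1 i := by
    intro i
    have hcoord : Continuous fun z : stdSimplex ℝ I => z.1 i :=
      (continuous_apply i).comp continuous_subtype_val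
    have h1 := (hcoord.tendsto x).comp (hx' i)
    have h2 := (((hcoord.comp hf).tendsto x).comp (hx' i)).add hε
    rw [add_zero] at h2
    exact le_of_tendsto_of_tendsto' h1 h2 fun n => hyf (φ n) i
  refine ⟨x, Subtype.ext (funext fun i => ?_)⟩
  have := (sum_eq_sum_iff_of_le fun i _ => hle i).1 (x.2.2.trans (f x).2.2.symm)
  exact (this i (mem_univ i)).symm

end Simplex

/-- The embedding `u ↦ u / n` of the cube into the simplex; the extra coordinate makes the
sum of the coordinates equal to one. -/
noncomputable def cubeToSimplex (n : ℕ) (u : Fin n → unitInterval) :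
    stdSimplex ℝ (Option (Fin n)) :=
  ⟨fun o => o.elim (1 - ∑ i, (u i : ℝ) / n) fun i => (u i : ℝ) / n, by
    constructor
    · rintro (_ | i)
      · simp only [Option.elim_none, sub_nonneg]
        rw [← Finset.sum_div]
        refine div_le_one_of_le₀ ?_ (Nat.cast_nonneg n)
        refine (Finset.sum_le_card_nsmul _ _ 1 fun i _ => (u i).2.2).trans ?_
        simp
      · exact div_nonneg (u i).2.1 (Nat.cast_nonneg n)
    · simp [Fintype.sum_option]⟩

/-- The retraction of the simplex onto the cube, left inverse to `cubeToSimplex`. -/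
noncomputable def simplexToCube (n : ℕ) (x : stdSimplex ℝ (Option (Fin n))) :
    Fin n → unitInterval :=
  fun i => Set.projIcc 0 1 zero_le_one (n * x.1 (some i))

theorem continuous_cubeToSimplex (n : ℕ) : Continuous (cubeToSimplex n) := by
  refine Continuous.subtype_mk (continuous_pi ?_) _
  rintro (_ | i)
  · simp only [Option.elim_none]
    fun_prop
  · simp only [Option.elim_some]
    fun_prop

theorem continuous_simplexToCube (n : ℕ) : Continuous (simplexToCube n) := by
  refine continuous_pi fun i => continuous_projIcc.comp ?_
  exact continuous_const.mul ((continuous_apply (some i)).comp continuous_subtype_val)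

theorem simplexToCube_cubeToSimplex {n : ℕ} (u : Fin n → unitInterval) :
    simplexToCube n (cubeToSimplex n u) = u := by
  funext i
  have hn : (n : ℝ) ≠ 0 := Nat.cast_ne_zero.2 (Fin.pos i).ne'
  simp only [simplexToCube, cubeToSimplex, Option.elim_some]
  rw [mul_div_cancel₀ _ hn, Set.projIcc_val]

/-- **Brouwer fixed-point theorem for the cube.** Every continuous map
`g : [0,1]^n → [0,1]^n` has a fixed point. -/
theorem brouwer_fixed_point_cube (n : ℕ)
    (g : (Fin n → unitInterval) → Fin n → unitInterval) (hg : Continuous g) :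
    ∃ x : Fin n → unitInterval, g x = x := by
  rcases Nat.eq_zero_or_pos n with rfl | hn
  · exact ⟨fun _ => 0, Subsingleton.elim _ _⟩
  · have : Nonempty (Fin n) := ⟨⟨0, hn⟩⟩
    obtain ⟨x, hx⟩ := exists_fixedPoint_stdSimplex
      ((continuous_cubeToSimplex n).comp (hg.comp (continuous_simplexToCube n)))
    refine ⟨simplexToCube n x, ?_⟩
    conv_rhs => rw [← hx]
    exact (simplexToCube_cubeToSimplex _).symm
end

section
/- Let g : [0,1]^n → [0,1]^n be continuous and suppose g(I_i^-) ⊆ I_i^- and g(I_i^+) ⊆ I_i^+ for all i = 1,…,n. Then g is surjective: g([0,1]^n) = [0,1]^n. -/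
namespace CubicalGrid

variable {ι : Type*}

/-- The point of the unit cube with coordinates `x i / k`, truncated at `1`. -/
noncomputable def gridPoint (k : ℕ) (x : ι → ℕ) : ι → unitInterval := fun i =>
  Set.projIcc 0 1 zero_le_one ((x i : ℝ) / k)

theorem dist_gridPoint_le [Fintype ι] {k : ℕ} {x y : ι → ℕ} (h : ∀ i, x i ≤ y i ∧ y i ≤ x i + 1) :
    dist (gridPoint k x) (gridPoint k y) ≤ 1 / k := by
  refine (dist_pi_le_iff (by positivity)).2 fun i => ?_
  refine (Set.abs_projIcc_sub_projIcc zero_le_one).trans ?_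
  rw [← sub_div, abs_div, Nat.abs_cast]
  gcongr
  have hle : (x i : ℝ) ≤ y i := by exact_mod_cast (h i).1
  have hge : (y i : ℝ) ≤ x i + 1 := by exact_mod_cast (h i).2
  rw [abs_le]
  constructor <;> linarith

theorem gridPoint_eq_zero {k : ℕ} {x : ι → ℕ} {i : ι} (h : x i = 0) : gridPoint k x i = 0 := by
  simp [gridPoint, h]

theorem gridPoint_eq_one {k : ℕ} (hk : 0 < k) {x : ι → ℕ} {i : ι} (h : k ≤ x i) :
    gridPoint k x i = 1 := by
  refine Set.projIcc_of_right_le _ ?_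
  rw [one_le_div (by exact_mod_cast hk)]
  exact_mod_cast h

/-- A mod 2 cubical cochain on the grid `ι → ℕ`: the cube based at `x` spanned by the directions
in `S` is represented by the pair `x`, `S`. -/
abbrev Cochain (ι : Type*) : Type _ := (ι → ℕ) → Finset ι → ZMod 2

/-- The product of a function on the vertices with a cochain. -/
def vertexMul (a : (ι → ℕ) → ZMod 2) (c : Cochain ι) : Cochain ι := fun x S => a x * c x S

theorem vertexMul_zero (a : (ι → ℕ) → ZMod 2) : vertexMul a 0 = 0 := by
  funext x S
  simp [vertexMul]

variable [DecidableEq ι]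

/-- The coboundary of a cubical cochain. -/
def coboundary (c : Cochain ι) : Cochain ι := fun x S =>
  ∑ i ∈ S, (c (x + Pi.single i 1) (S.erase i) + c x (S.erase i))

/-- The cup product of the coboundary of a function on the vertices with a cochain. -/
def coboundaryCup (a : (ι → ℕ) → ZMod 2) (c : Cochain ι) : Cochain ι := fun x S =>
  ∑ i ∈ S, (a (x + Pi.single i 1) + a x) * c (x + Pi.single i 1) (S.erase i)

/-- The iterated cup product of the coboundaries of the vertex functions `a i`, for `i` in a
list. -/
def cupList (a : ι → (ι → ℕ) → ZMod 2) : List ι → Cochain ι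
  | [] => fun _ S => if S = ∅ then 1 else 0
  | i :: L => coboundaryCup (a i) (cupList a L)

theorem sum_sum_erase_eq_zero (S : Finset ι) (f : ι → ι → ZMod 2) (hf : ∀ i j, f i j = f j i) :
    ∑ i ∈ S, ∑ j ∈ S.erase i, f i j = 0 := by
  rw [Finset.sum_sigma']
  refine Finset.sum_involution (fun p _ => ⟨p.2, p.1⟩) ?_ ?_ ?_ ?_
  · rintro ⟨i, j⟩ _
    simp only [hf j i, CharTwo.add_self_eq_zero]
  · rintro ⟨i, j⟩ h _ heq
    simp only [Finset.mem_sigma, Finset.mem_erase] at h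
    exact h.2.1 (congrArg Sigma.fst heq)
  · rintro ⟨i, j⟩ h
    simp only [Finset.mem_sigma, Finset.mem_erase] at h ⊢
    exact ⟨h.2.2, h.2.1.symm, h.1⟩
  · rintro ⟨i, j⟩ _
    rfl

theorem coboundary_coboundary (c : Cochain ι) : coboundary (coboundary c) = 0 := by
  funext x S
  simp only [coboundary, ← Finset.sum_add_distrib]
  refine sum_sum_erase_eq_zero S (fun i j =>
    c (x + Pi.single i 1 + Pi.single j 1) ((S.erase i).erase j) +
      c (x + Pi.single i 1) ((S.erase i).erase j) +
      (c (x + Pi.single j 1) ((S.erase i).erase j) + c x ((S.erase i).erase j))) fun i j => ?_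
  simp only [Finset.erase_right_comm (a := i) (b := j), add_right_comm x (Pi.single i 1)]
  ring

theorem coboundary_vertexMul (a : (ι → ℕ) → ZMod 2) (c : Cochain ι) :
    coboundary (vertexMul a c) = coboundaryCup a c + vertexMul a (coboundary c) := by
  funext x S
  simp only [coboundary, vertexMul, coboundaryCup, Pi.add_apply, Finset.mul_sum,
    ← Finset.sum_add_distrib]
  refine Finset.sum_congr rfl fun i _ => ?_
  linear_combination -CharTwo.add_self_eq_zero (a x * c (x + Pi.single i 1) (S.erase i))

theorem coboundaryCup_eq_coboundary (a : (ι → ℕ) → ZMod 2) {c : Cochain ι}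
    (hc : coboundary c = 0) : coboundaryCup a c = coboundary (vertexMul a c) := by
  rw [coboundary_vertexMul, hc, vertexMul_zero, add_zero]

theorem coboundary_cupList (a : ι → (ι → ℕ) → ZMod 2) (L : List ι) :
    coboundary (cupList a L) = 0 := by
  cases L with
  | nil =>
    funext x S
    exact Finset.sum_eq_zero fun i _ => CharTwo.add_self_eq_zero _
  | cons i L =>
    rw [cupList, coboundaryCup_eq_coboundary _ (coboundary_cupList a L), coboundary_coboundary]

theorem cupList_eq_zero_of_face {a : ι → (ι → ℕ) → ZMod 2} {j : ι} {t : ℕ} {b : ZMod 2}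
    (ha : ∀ x, x j = t → a j x = b) {L : List ι} (hj : j ∈ L) {x : ι → ℕ} {S : Finset ι}
    (hx : x j = t) (hS : j ∉ S) : cupList a L x S = 0 := by
  induction L generalizing x S with
  | nil => simp at hj
  | cons i L ih =>
    refine Finset.sum_eq_zero fun l hl => ?_
    have hlj : j ≠ l := fun h => hS (h ▸ hl)
    have hx' : (x + Pi.single l 1 : ι → ℕ) j = t := by simp [hlj, hx]
    rcases List.mem_cons.1 hj with rfl | hj
    · rw [ha _ hx, ha _ hx', CharTwo.add_self_eq_zero, zero_mul]
    · rw [ih hj hx' fun h => hS (Finset.mem_of_mem_erase h), mul_zero]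

theorem exists_ne_of_cupList_ne_zero {a : ι → (ι → ℕ) → ZMod 2} {L : List ι} {x : ι → ℕ}
    {S : Finset ι} (h : cupList a L x S ≠ 0) {j : ι} (hj : j ∈ L) :
    ∃ y z : ι → ℕ, (∀ i, x i ≤ y i ∧ y i ≤ x i + if i ∈ S then 1 else 0) ∧
      (∀ i, x i ≤ z i ∧ z i ≤ x i + if i ∈ S then 1 else 0) ∧ a j y ≠ a j z := by
  induction L generalizing x S with
  | nil => simp at hj
  | cons i L ih =>
    obtain ⟨l, hl, hne⟩ := Finset.exists_ne_zero_of_sum_ne_zero h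
    rcases List.mem_cons.1 hj with rfl | hj
    · refine ⟨x + Pi.single l 1, x, fun i => ?_, fun i => by simp,
        fun h => left_ne_zero_of_mul hne (by rw [h, CharTwo.add_self_eq_zero])⟩
      rcases eq_or_ne i l with rfl | hil
      · simp [hl]
      · simp [hil]
    · obtain ⟨y, z, hy, hz, hyz⟩ := ih (right_ne_zero_of_mul hne) hj
      have key : ∀ w : ι → ℕ, (∀ i, (x + Pi.single l 1 : ι → ℕ) i ≤ w i ∧
          w i ≤ (x + Pi.single l 1 : ι → ℕ) i + if i ∈ S.erase l then 1 else 0) →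
          ∀ i, x i ≤ w i ∧ w i ≤ x i + if i ∈ S then 1 else 0 := by
        intro w hw i
        have := hw i
        rcases eq_or_ne i l with rfl | hil
        · simp only [Pi.add_apply, Pi.single_eq_same, Finset.notMem_erase, if_false] at this
          rw [if_pos hl]
          omega
        · simpa [hil] using this
      exact ⟨y, z, key y hy, key z hz, hyz⟩

variable [Fintype ι]

/-- Base points of the `S`-directional unit cubes in the face of `[0, k]^ι` on which the
coordinates outside `S` equal `k`. -/
def faceBox (k : ℕ) (S : Finset ι) : Finset (ι → ℕ) :=
  Fintype.piFinset fun j => if j ∈ S then Finset.range k else {k}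

theorem mem_faceBox {k : ℕ} {S : Finset ι} {x : ι → ℕ} :
    x ∈ faceBox k S ↔ ∀ j, if j ∈ S then x j < k else x j = k := by
  simp only [faceBox, Fintype.mem_piFinset]
  refine forall_congr' fun j => ?_
  split_ifs <;> simp

theorem sum_faceBox_eq_sum_erase {M : Type*} [AddCommMonoid M] (k : ℕ) {S : Finset ι} {j : ι}
    (hj : j ∈ S) (F : (ι → ℕ) → M) :
    ∑ x ∈ faceBox k S, F x =
      ∑ z ∈ faceBox k (S.erase j), ∑ t ∈ Finset.range k, F (Function.update z j t) := by
  rw [← Finset.sum_product']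
  refine Finset.sum_nbij' (fun x => (Function.update x j k, x j))
    (fun p => Function.update p.1 j p.2) ?_ ?_ ?_ ?_ ?_
  · intro x hx
    rw [mem_faceBox] at hx
    simp only [Finset.mem_product, mem_faceBox, Finset.mem_range]
    refine ⟨fun i => ?_, by simpa [hj] using hx j⟩
    rcases eq_or_ne i j with rfl | hij
    · simp
    · simpa [hij] using hx i
  · rintro ⟨z, t⟩ hz
    simp only [Finset.mem_product, mem_faceBox, Finset.mem_range] at hz ⊢
    intro i
    rcases eq_or_ne i j with rfl | hij
    · simpa [hj] using hz.2
    · simpa [hij] using hz.1 i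
  · intro x _
    simp
  · rintro ⟨z, t⟩ hz
    simp only [Finset.mem_product, mem_faceBox] at hz
    have := hz.1 j
    simp only [Finset.notMem_erase, if_false] at this
    simp [← this]
  · intro x _
    simp

/-- The mod 2 Stokes formula on a grid. -/
theorem sum_coboundary (k : ℕ) (S : Finset ι) (c : Cochain ι) :
    ∑ x ∈ faceBox k S, coboundary c x S =
      ∑ j ∈ S, ∑ z ∈ faceBox k (S.erase j),
        (c z (S.erase j) + c (Function.update z j 0) (S.erase j)) := by
  simp only [coboundary]
  rw [Finset.sum_comm]
  refine Finset.sum_congr rfl fun j hj => ?_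
  rw [sum_faceBox_eq_sum_erase k hj]
  refine Finset.sum_congr rfl fun z hz => ?_
  have hupd : ∀ t : ℕ, Function.update z j t + Pi.single j 1 = Function.update z j (t + 1) := by
    intro t
    ext i
    rcases eq_or_ne i j with rfl | hij
    · simp
    · simp [hij]
  have hzj : Function.update z j k = z := by
    have := mem_faceBox.1 hz j
    simp only [Finset.notMem_erase, if_false] at this
    simp [← this]
  simp only [hupd, ← CharTwo.sub_eq_add]
  rw [Finset.sum_range_sub (fun t => c (Function.update z j t) (S.erase j)), hzj]

theorem sum_cupList_eq_one {k : ℕ} {a : ι → (ι → ℕ) → ZMod 2}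
    (h0 : ∀ i x, x i = 0 → a i x = 0) (h1 : ∀ i x, x i = k → a i x = 1) {L : List ι}
    (hL : L.Nodup) : ∑ x ∈ faceBox k L.toFinset, cupList a L x L.toFinset = 1 := by
  induction L with
  | nil => simp [faceBox, cupList]
  | cons i L ih =>
    obtain ⟨hi, hL⟩ := List.nodup_cons.1 hL
    rw [cupList, coboundaryCup_eq_coboundary _ (coboundary_cupList a L), sum_coboundary,
      Finset.sum_eq_single i]
    · have herase : (i :: L).toFinset.erase i = L.toFinset := by
        rw [List.toFinset_cons, Finset.erase_insert (by simpa using hi)]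
      rw [herase, ← ih hL]
      refine Finset.sum_congr rfl fun z hz => ?_
      have hzi : z i = k := by simpa [hi] using mem_faceBox.1 hz i
      simp [vertexMul, h1 i z hzi, h0 i (Function.update z i 0)]
    · intro j hj hji
      have hjL : j ∈ L := by simpa [hji] using hj
      refine Finset.sum_eq_zero fun z hz => ?_
      have hzj : z j = k := by simpa using mem_faceBox.1 hz j
      simp only [vertexMul]
      rw [cupList_eq_zero_of_face (h1 j) hjL hzj (Finset.notMem_erase _ _),
        cupList_eq_zero_of_face (h0 j) hjL (Function.update_self _ _ _) (Finset.notMem_erase _ _)]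
      simp
    · intro h
      simp at h

/-- The cubical Sperner lemma of Kuhn. -/
theorem exists_cube_forall_exists_ne {k : ℕ} {a : ι → (ι → ℕ) → ZMod 2}
    (h0 : ∀ i x, x i = 0 → a i x = 0) (h1 : ∀ i x, x i = k → a i x = 1) :
    ∃ x : ι → ℕ, ∀ j, ∃ y z : ι → ℕ, (∀ i, x i ≤ y i ∧ y i ≤ x i + 1) ∧
      (∀ i, x i ≤ z i ∧ z i ≤ x i + 1) ∧ a j y ≠ a j z := by
  have hsum := sum_cupList_eq_one h0 h1 (Finset.univ : Finset ι).nodup_toList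
  obtain ⟨x, -, hx⟩ := Finset.exists_ne_zero_of_sum_ne_zero (hsum.trans_ne one_ne_zero)
  refine ⟨x, fun j => ?_⟩
  simpa using exists_ne_of_cupList_ne_zero hx (Finset.mem_toList.2 (Finset.mem_univ j))

theorem exists_cube_forall_exists_le_le {k : ℕ} (hk : 0 < k)
    {g : (ι → unitInterval) → ι → unitInterval} (h0 : ∀ i p, p i = 0 → g p i = 0)
    (h1 : ∀ i p, p i = 1 → g p i = 1) (q : ι → unitInterval) :
    ∃ x : ι → ℕ, ∀ j, ∃ y z : ι → ℕ, (∀ i, x i ≤ y i ∧ y i ≤ x i + 1) ∧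
      (∀ i, x i ≤ z i ∧ z i ≤ x i + 1) ∧
        g (gridPoint k y) j ≤ q j ∧ q j ≤ g (gridPoint k z) j := by
  let a : ι → (ι → ℕ) → ZMod 2 := fun i x =>
    if x i = 0 ∨ x i < k ∧ g (gridPoint k x) i ≤ q i then 0 else 1
  have hle : ∀ i x, a i x = 0 → g (gridPoint k x) i ≤ q i := by
    intro i x hx
    simp only [a, ite_eq_left_iff, one_ne_zero, imp_false, not_not] at hx
    rcases hx with hx | hx
    · rw [h0 i _ (gridPoint_eq_zero hx)]
      exact unitInterval.nonneg'
    · exact hx.2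
  have hge : ∀ i x, a i x ≠ 0 → q i ≤ g (gridPoint k x) i := by
    intro i x hx
    have hx' : ¬(x i = 0 ∨ x i < k ∧ g (gridPoint k x) i ≤ q i) := fun h => hx (if_pos h)
    rcases lt_or_ge (x i) k with hlt | hge
    · exact (lt_of_not_ge fun h => hx' (Or.inr ⟨hlt, h⟩)).le
    · rw [h1 i _ (gridPoint_eq_one hk hge)]
      exact unitInterval.le_one'
  obtain ⟨x, hx⟩ := exists_cube_forall_exists_ne (k := k) (a := a)
    (fun i x hx => if_pos (Or.inl hx))
    (fun i x hx => if_neg (by omega))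
  refine ⟨x, fun j => ?_⟩
  obtain ⟨y, z, hy, hz, hyz⟩ := hx j
  by_cases hay : a j y = 0
  · exact ⟨y, z, hy, hz, hle j y hay, hge j z fun h => hyz (hay.trans h.symm)⟩
  · refine ⟨z, y, hz, hy, hle j z ?_, hge j y hay⟩
    simp only [a] at hay hyz ⊢
    split_ifs at hay hyz ⊢ <;> simp_all

/-- A continuous self-map of the unit cube which maps each face to itself is surjective. -/
theorem surjective_of_faces {g : (ι → unitInterval) → ι → unitInterval} (hg : Continuous g)
    (h0 : ∀ i p, p i = 0 → g p i = 0) (h1 : ∀ i p, p i = 1 → g p i = 1) :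
    Function.Surjective g := by
  intro q
  rw [← Set.mem_range, ← (isCompact_range hg).isClosed.closure_eq, Metric.mem_closure_range_iff]
  intro ε hε
  obtain ⟨δ, hδ, hgδ⟩ := Metric.uniformContinuous_iff.1
    (CompactSpace.uniformContinuous_of_continuous hg) ε hε
  obtain ⟨m, hm⟩ := exists_nat_one_div_lt hδ
  obtain ⟨x, hx⟩ := exists_cube_forall_exists_le_le m.succ_pos h0 h1 q
  have hclose : ∀ y : ι → ℕ, (∀ i, x i ≤ y i ∧ y i ≤ x i + 1) → ∀ j,
      |(g (gridPoint (m + 1) x) j : ℝ) - g (gridPoint (m + 1) y) j| < ε := by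
    intro y hy j
    refine (dist_le_pi_dist (g (gridPoint (m + 1) x)) (g (gridPoint (m + 1) y)) j).trans_lt
      (hgδ ((dist_gridPoint_le hy).trans_lt ?_))
    exact_mod_cast hm
  refine ⟨gridPoint (m + 1) x, (dist_pi_lt_iff hε).2 fun j => ?_⟩
  obtain ⟨y, z, hy, hz, hyj, hzj⟩ := hx j
  have hy' := abs_lt.1 (hclose y hy j)
  have hz' := abs_lt.1 (hclose z hz j)
  have hyj' : (g (gridPoint (m + 1) y) j : ℝ) ≤ q j := hyj
  have hzj' : (q j : ℝ) ≤ g (gridPoint (m + 1) z) j := hzj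
  change |(q j : ℝ) - g (gridPoint (m + 1) x) j| < ε
  rw [abs_lt]
  constructor <;> linarith [hy'.1, hy'.2, hz'.1, hz'.2]

end CubicalGrid

/-- Let `g : [0,1]^n → [0,1]^n` be continuous with `g(I_i^-) ⊆ I_i^-` and
`g(I_i^+) ⊆ I_i^+` for all `i = 1,…,n`, where `I_i^- = {x : x_i = 0}` and
`I_i^+ = {x : x_i = 1}` are the faces. Then `g` is surjective: `g([0,1]^n) = [0,1]^n`. -/
theorem surjective_of_mapsTo_faces (n : ℕ)
    (g : (Fin n → unitInterval) → Fin n → unitInterval) (hg : Continuous g)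
    (hminus : ∀ i : Fin n,
      g '' {x : Fin n → unitInterval | x i = 0} ⊆ {x : Fin n → unitInterval | x i = 0})
    (hplus : ∀ i : Fin n,
      g '' {x : Fin n → unitInterval | x i = 1} ⊆ {x : Fin n → unitInterval | x i = 1}) :
    g '' Set.univ = Set.univ := by
  rw [Set.image_univ, Set.range_eq_univ]
  exact CubicalGrid.surjective_of_faces hg
    (fun i p hp => hminus i (Set.mem_image_of_mem g hp))
    (fun i p hp => hplus i (Set.mem_image_of_mem g hp))
end

section
/- Every continuous map g : [0,1]^n → [0,1]^n whose restriction to the topological boundary ∂[0,1]^n is the identity is surjective: g([0,1]^n) = [0,1]^n. -/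
namespace CubicalCochain

variable {n : ℕ}

/-- Functions of a lattice point and a set of directions, with values in `ZMod 2`. Evaluating at
`(x, A)` reads off a value on the unit cube with least vertex `x` and edge directions `A`. -/
abbrev Cochain (n : ℕ) := (Fin n → ℤ) → Finset (Fin n) → ZMod 2

/-- The operator summing over all ways to use up one direction `d`, translating by `s d`. -/
def step (s : Fin n → Fin n → ℤ) : Module.End (ZMod 2) (Cochain n) where
  toFun φ x A := ∑ d ∈ A, φ (x + s d) (A.erase d)
  map_add' φ ψ := by
    funext x A
    simp [Finset.sum_add_distrib]
  map_smul' c φ := by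
    funext x A
    simp [Finset.mul_sum]

/-- Multiplication by a function on the lattice. -/
def mul (f : (Fin n → ℤ) → ZMod 2) : Module.End (ZMod 2) (Cochain n) where
  toFun φ x A := f x * φ x A
  map_add' φ ψ := by
    funext x A
    simp [mul_add]
  map_smul' c φ := by
    funext x A
    simp [mul_left_comm]

/-- The step operator moving along the coordinate directions. -/
def shift : Module.End (ZMod 2) (Cochain n) := step fun d => Pi.single d 1

/-- The commutator of `shift` and multiplication by `f`: the cup product with the coboundary
of `f`. -/
def cupD (f : (Fin n → ℤ) → ZMod 2) : Module.End (ZMod 2) (Cochain n) :=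
  shift * mul f + mul f * shift

/-- The unit cochain, supported on vertices. -/
def one : Cochain n := fun _ A => if A = ∅ then 1 else 0

theorem step_apply (s : Fin n → Fin n → ℤ) (φ : Cochain n) (x : Fin n → ℤ)
    (A : Finset (Fin n)) : step s φ x A = ∑ d ∈ A, φ (x + s d) (A.erase d) := rfl

theorem shift_apply (φ : Cochain n) (x : Fin n → ℤ) (A : Finset (Fin n)) :
    shift φ x A = ∑ d ∈ A, φ (x + Pi.single d 1) (A.erase d) := rfl

theorem mul_apply (f : (Fin n → ℤ) → ZMod 2) (φ : Cochain n) (x : Fin n → ℤ)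
    (A : Finset (Fin n)) : mul f φ x A = f x * φ x A := rfl

theorem cupD_apply (f : (Fin n → ℤ) → ZMod 2) (φ : Cochain n) (x : Fin n → ℤ)
    (A : Finset (Fin n)) :
    cupD f φ x A =
      ∑ d ∈ A, (f (x + Pi.single d 1) + f x) * φ (x + Pi.single d 1) (A.erase d) := by
  simp [cupD, shift_apply, mul_apply, Finset.mul_sum, add_mul, Finset.sum_add_distrib]

theorem commute_step (s t : Fin n → Fin n → ℤ) : Commute (step s) (step t) := by
  ext φ x A
  simp only [Module.End.mul_apply, step_apply]
  rw [Finset.sum_comm' (t' := A) (s' := fun e => A.erase e)]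
  · refine Finset.sum_congr rfl fun e _ => Finset.sum_congr rfl fun d _ => ?_
    rw [Finset.erase_right_comm, add_right_comm]
  · intro d e
    simp only [Finset.mem_erase]
    tauto

theorem shift_mul_shift : (shift * shift : Module.End (ZMod 2) (Cochain n)) = 0 := by
  ext φ x A
  simp only [Module.End.mul_apply, shift_apply, LinearMap.zero_apply, Pi.zero_apply]
  rw [Finset.sum_sigma']
  refine Finset.sum_involution (fun p _ => ⟨p.2, p.1⟩) ?_ ?_ ?_ ?_
  · rintro ⟨d, e⟩ _
    simp only
    rw [Finset.erase_right_comm, add_right_comm]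
    exact CharTwo.add_self_eq_zero _
  · rintro ⟨d, e⟩ h _ heq
    simp only [Finset.mem_sigma, Finset.mem_erase] at h
    simp only [Sigma.mk.injEq] at heq
    exact h.2.1 heq.1
  · rintro ⟨d, e⟩ h
    simp only [Finset.mem_sigma, Finset.mem_erase] at h ⊢
    tauto
  · rintro ⟨d, e⟩ _
    rfl

theorem commute_step_zero_mul (f : (Fin n → ℤ) → ZMod 2) : Commute (step 0) (mul f) := by
  ext φ x A
  simp [Module.End.mul_apply, step_apply, mul_apply, Finset.mul_sum]

theorem commute_step_zero_cupD (f : (Fin n → ℤ) → ZMod 2) : Commute (step 0) (cupD f) :=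
  ((commute_step _ _).mul_right (commute_step_zero_mul f)).add_right
    ((commute_step_zero_mul f).mul_right (commute_step _ _))

theorem commute_shift_cupD (f : (Fin n → ℤ) → ZMod 2) : Commute shift (cupD f) := by
  have h := shift_mul_shift (n := n)
  unfold Commute SemiconjBy cupD
  rw [mul_add, add_mul, ← mul_assoc, h, zero_mul, mul_assoc (mul f), h, mul_zero, zero_add,
    add_zero, mul_assoc]

theorem cupD_sub (f f' : (Fin n → ℤ) → ZMod 2) : cupD f - cupD f' = cupD (f - f') := by
  ext φ x A
  simp only [LinearMap.sub_apply, Pi.sub_apply, cupD_apply, ← Finset.sum_sub_distrib]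
  refine Finset.sum_congr rfl fun d _ => ?_
  ring

theorem shift_one : shift (one : Cochain n) = step 0 one := by
  funext x A
  simp [shift_apply, step_apply, one]

/-- Leibniz rule: a cup product of coboundaries is a coboundary. -/
theorem mul_cupD_mul {L₁ L₂ : Module.End (ZMod 2) (Cochain n)} (h₁ : Commute shift L₁)
    (h₂ : Commute shift L₂) (f : (Fin n → ℤ) → ZMod 2) :
    L₁ * cupD f * L₂ = shift * (L₁ * mul f * L₂) + L₁ * mul f * L₂ * shift := by
  simp only [cupD, mul_add, add_mul, mul_assoc]
  rw [← h₂.eq, ← mul_assoc shift L₁, h₁.eq, mul_assoc]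

theorem finsum_shift_add_step_zero (b : Cochain n)
    (hb : ∀ A, (Function.support fun x => b x A).Finite) :
    ∑ᶠ x, (shift b + step 0 b) x Finset.univ = 0 := by
  have h1 : ∀ d : Fin n,
      (Function.support fun x => b (x + Pi.single d 1) (Finset.univ.erase d)).Finite := fun d =>
    (hb (Finset.univ.erase d)).preimage
      (add_left_injective (Pi.single d 1 : Fin n → ℤ)).injOn
  have h2 : ∀ d : Fin n, (Function.support fun x => b x (Finset.univ.erase d)).Finite :=
    fun d => hb _
  simp only [Pi.add_apply, shift_apply, step_apply, Pi.zero_apply, add_zero,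
    ← Finset.sum_add_distrib]
  rw [finsum_sum_comm _ _ fun d _ => ((h1 d).union (h2 d)).subset (Function.support_add _ _)]
  refine Finset.sum_eq_zero fun d _ => ?_
  rw [finsum_add_distrib (h1 d) (h2 d)]
  have := finsum_comp_equiv (f := fun x => b x (Finset.univ.erase d))
    (Equiv.addRight (Pi.single d 1 : Fin n → ℤ))
  simp only [Equiv.coe_addRight] at this
  rw [this]
  exact CharTwo.add_self_eq_zero _

/-- A set of cubes containing, with a cube, all its faces not touching the least vertex in some
direction. -/
def MoveClosed (U : Set ((Fin n → ℤ) × Finset (Fin n))) : Prop :=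
  ∀ x A, (x, A) ∈ U → ∀ d ∈ A, (x + Pi.single d 1, A.erase d) ∈ U

/-- Cochains vanishing on `U`. -/
def VanishOn (U : Set ((Fin n → ℤ) × Finset (Fin n))) (φ : Cochain n) : Prop :=
  ∀ x A, (x, A) ∈ U → φ x A = 0

theorem VanishOn.mul {U : Set ((Fin n → ℤ) × Finset (Fin n))} {φ : Cochain n}
    (h : VanishOn U φ) (f : (Fin n → ℤ) → ZMod 2) : VanishOn U (mul f φ) := fun x A hx => by
  rw [mul_apply, h x A hx, mul_zero]

theorem VanishOn.cupD {U : Set ((Fin n → ℤ) × Finset (Fin n))} (hU : MoveClosed U)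
    {φ : Cochain n} (h : VanishOn U φ) (f : (Fin n → ℤ) → ZMod 2) :
    VanishOn U (cupD f φ) := fun x A hx => by
  rw [cupD_apply]
  exact Finset.sum_eq_zero fun d hd => by rw [h _ _ (hU x A hx d hd), mul_zero]

theorem vanishOn_cupD {U : Set ((Fin n → ℤ) × Finset (Fin n))} (hU : MoveClosed U)
    {f : (Fin n → ℤ) → ZMod 2} {c : ZMod 2} (hf : ∀ x A, (x, A) ∈ U → f x = c)
    (φ : Cochain n) : VanishOn U (CubicalCochain.cupD f φ) := fun x A hx => by
  rw [cupD_apply]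
  refine Finset.sum_eq_zero fun d hd => ?_
  rw [hf _ _ hx, hf _ _ (hU x A hx d hd), CharTwo.add_self_eq_zero, zero_mul]

theorem VanishOn.list_prod {U : Set ((Fin n → ℤ) × Finset (Fin n))} (hU : MoveClosed U)
    {φ : Cochain n} (h : VanishOn U φ) (f : Fin n → (Fin n → ℤ) → ZMod 2) (l : List (Fin n)) :
    VanishOn U ((l.map fun j => CubicalCochain.cupD (f j)).prod φ) := by
  induction l with
  | nil => simpa using h
  | cons j l ih =>
    rw [List.map_cons, List.prod_cons, Module.End.mul_apply]
    exact ih.cupD hU _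

theorem vanishOn_list_prod {U : Set ((Fin n → ℤ) × Finset (Fin n))} (hU : MoveClosed U)
    {f : Fin n → (Fin n → ℤ) → ZMod 2} {l : List (Fin n)} {j : Fin n} (hj : j ∈ l)
    {c : ZMod 2} (hf : ∀ x A, (x, A) ∈ U → f j x = c) (φ : Cochain n) :
    VanishOn U ((l.map fun j => cupD (f j)).prod φ) := by
  obtain ⟨l₁, l₂, rfl⟩ := List.append_of_mem hj
  rw [List.map_append, List.map_cons, List.prod_append, List.prod_cons, Module.End.mul_apply,
    Module.End.mul_apply]
  exact (vanishOn_cupD hU hf _).list_prod hU f l₁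

theorem moveClosed_ge (j : Fin n) (N : ℤ) :
    MoveClosed {p : (Fin n → ℤ) × Finset (Fin n) | N ≤ p.1 j} := by
  intro x A hx d _
  simp only [Set.mem_ofPred_eq, Pi.add_apply] at hx ⊢
  rcases eq_or_ne j d with rfl | h
  · rw [Pi.single_eq_same]; omega
  · rw [Pi.single_eq_of_ne h]; omega

theorem moveClosed_le (j : Fin n) :
    MoveClosed {p : (Fin n → ℤ) × Finset (Fin n) | p.1 j ≤ 0 ∧ (j ∈ p.2 → p.1 j < 0)} := by
  intro x A hx d hd
  simp only [Set.mem_ofPred_eq, Pi.add_apply, Finset.mem_erase] at hx ⊢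
  rcases eq_or_ne j d with rfl | h
  · have := hx.2 hd
    rw [Pi.single_eq_same]
    exact ⟨by omega, fun h => absurd rfl h.1⟩
  · rw [Pi.single_eq_of_ne h, add_zero]
    exact ⟨hx.1, fun h' => hx.2 h'.2⟩

theorem moveClosed_cube (x : Fin n → ℤ) :
    MoveClosed {p : (Fin n → ℤ) × Finset (Fin n) |
      (∀ d, x d ≤ p.1 d ∧ p.1 d ≤ x d + 1) ∧ ∀ d ∈ p.2, p.1 d = x d} := by
  intro y A hy d hd
  simp only [Set.mem_ofPred_eq, Pi.add_apply, Finset.mem_erase] at hy ⊢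
  refine ⟨fun e => ?_, fun e he => ?_⟩
  · rcases eq_or_ne e d with rfl | h
    · have := hy.2 e hd
      rw [Pi.single_eq_same]; omega
    · rw [Pi.single_eq_of_ne h, add_zero]; exact hy.1 e
  · rw [Pi.single_eq_of_ne he.1, add_zero]; exact hy.2 e he.2

/-- If a cochain vanishes far out in each coordinate direction then it has finite support. -/
theorem finite_support_of_vanishOn {N : ℤ} {φ : Cochain n}
    (hge : ∀ j, VanishOn {p | N ≤ p.1 j} φ)
    (hle : ∀ j, VanishOn {p | p.1 j ≤ 0 ∧ (j ∈ p.2 → p.1 j < 0)} φ) (A : Finset (Fin n)) :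
    (Function.support fun x => φ x A).Finite := by
  refine (Set.finite_Icc (0 : Fin n → ℤ) fun _ => N).subset fun x hx => ?_
  refine ⟨fun j => ?_, fun j => ?_⟩
  · by_contra! h
    simp only [Pi.zero_apply] at h
    exact hx (hle j x A ⟨h.le, fun _ => h⟩)
  · by_contra! h
    exact hx (hge j x A h.le)

/-- Each `f j` is a two-valued labelling separating the opposite faces of `[0, N]^n` in
direction `j`. -/
def Separating (N : ℤ) (f : Fin n → (Fin n → ℤ) → ZMod 2) : Prop :=
  ∀ j x, (x j ≤ 0 → f j x = 0) ∧ (N ≤ x j → f j x = 1)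

/-- The cup product of the coboundaries of all `f j`. -/
def cupProd (f : Fin n → (Fin n → ℤ) → ZMod 2) : Cochain n :=
  ((List.finRange n).map fun j => cupD (f j)).prod one

theorem Separating.finite_support {N : ℤ} {f : Fin n → (Fin n → ℤ) → ZMod 2}
    (hf : Separating N f) (A : Finset (Fin n)) :
    (Function.support fun x => cupProd f x A).Finite :=
  finite_support_of_vanishOn
    (fun j => vanishOn_list_prod (moveClosed_ge j N) (List.mem_finRange j)
      (fun x _ hx => (hf j x).2 hx) _)
    (fun j => vanishOn_list_prod (moveClosed_le j) (List.mem_finRange j)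
      (fun x _ hx => (hf j x).1 hx.1) _) A

theorem finsum_cupProd_congr_of_eq_off {N : ℤ} {f f' : Fin n → (Fin n → ℤ) → ZMod 2}
    (hf : Separating N f) (hf' : Separating N f') (i : Fin n) (h : ∀ j, j ≠ i → f j = f' j) :
    ∑ᶠ x, cupProd f x Finset.univ = ∑ᶠ x, cupProd f' x Finset.univ := by
  rw [← sub_eq_zero, ← finsum_sub_distrib (hf.finite_support _) (hf'.finite_support _)]
  obtain ⟨l₁, l₂, hl⟩ := List.append_of_mem (List.mem_finRange i)
  have hnd := List.nodup_finRange n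
  rw [hl, List.nodup_middle, List.nodup_cons, List.mem_append, not_or] at hnd
  have e₁ : (l₁.map fun j => cupD (f' j)) = l₁.map fun j => cupD (f j) :=
    List.map_congr_left fun j hj => by rw [h j (by rintro rfl; exact hnd.1.1 hj)]
  have e₂ : (l₂.map fun j => cupD (f' j)) = l₂.map fun j => cupD (f j) :=
    List.map_congr_left fun j hj => by rw [h j (by rintro rfl; exact hnd.1.2 hj)]
  set L₁ := (l₁.map fun j => cupD (f j)).prod with hL₁
  set L₂ := (l₂.map fun j => cupD (f j)).prod with hL₂
  have hcomm : ∀ (T : Module.End (ZMod 2) (Cochain n)), (∀ g, Commute T (cupD g)) →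
      ∀ l : List (Fin n), Commute T (l.map fun j => cupD (f j)).prod := fun T hT l =>
    Commute.list_prod_right _ _ fun S hS => by
      obtain ⟨j, _, rfl⟩ := List.mem_map.1 hS
      exact hT _
  set μ := f i - f' i with hμ
  set b := (L₁ * mul μ * L₂) one with hb
  have key : cupProd f - cupProd f' = shift b + step 0 b := by
    have : cupProd f - cupProd f' = (L₁ * cupD μ * L₂) one := by
      simp only [cupProd, hl, List.map_append, List.map_cons, List.prod_append, List.prod_cons,
        e₁, e₂, ← hL₁, ← hL₂, hμ, ← cupD_sub, ← mul_assoc, mul_sub, sub_mul,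
        LinearMap.sub_apply]
    rw [this, mul_cupD_mul (hcomm _ commute_shift_cupD l₁) (hcomm _ commute_shift_cupD l₂),
      LinearMap.add_apply, Module.End.mul_apply, Module.End.mul_apply _ shift, shift_one,
      ← Module.End.mul_apply _ (step 0)]
    rw [← (((hcomm _ commute_step_zero_cupD l₁).mul_right
      (commute_step_zero_mul μ)).mul_right (hcomm _ commute_step_zero_cupD l₂)).eq]
    rfl
  have hvan : ∀ (U : Set ((Fin n → ℤ) × Finset (Fin n))) (c : ZMod 2) (j : Fin n),
      MoveClosed U → (∀ x A, (x, A) ∈ U → f j x = c) → (∀ x A, (x, A) ∈ U → f' j x = c) →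
      VanishOn U b := by
    intro U c j hU hc hc'
    have hmem : j ∈ l₁ ++ i :: l₂ := hl ▸ List.mem_finRange j
    rw [hb, mul_assoc, Module.End.mul_apply, Module.End.mul_apply]
    rcases List.mem_append.1 hmem with hj | hj
    · exact vanishOn_list_prod hU hj hc _
    refine VanishOn.list_prod hU ?_ f l₁
    rcases List.mem_cons.1 hj with rfl | hj
    · intro x A hx
      rw [mul_apply, hμ, Pi.sub_apply, hc x A hx, hc' x A hx, sub_self, zero_mul]
    · exact (vanishOn_list_prod hU hj hc _).mul _
  have hfin := finsum_shift_add_step_zero b (finite_support_of_vanishOn (N := N)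
    (fun j => hvan _ 1 j (moveClosed_ge j N) (fun x _ hx => (hf j x).2 hx)
      fun x _ hx => (hf' j x).2 hx)
    (fun j => hvan _ 0 j (moveClosed_le j) (fun x _ hx => (hf j x).1 hx.1)
      fun x _ hx => (hf' j x).1 hx.1))
  rw [← key] at hfin
  exact hfin

theorem finsum_cupProd_congr {N : ℤ} {f f' : Fin n → (Fin n → ℤ) → ZMod 2}
    (hf : Separating N f) (hf' : Separating N f') :
    ∑ᶠ x, cupProd f x Finset.univ = ∑ᶠ x, cupProd f' x Finset.univ := by
  have hsep : ∀ s : Finset (Fin n), Separating N (s.piecewise f' f) := fun s j x => by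
    by_cases h : j ∈ s
    · rw [Finset.piecewise_eq_of_mem _ _ _ h]; exact hf' j x
    · rw [Finset.piecewise_eq_of_notMem _ _ _ h]; exact hf j x
  have H : ∀ s : Finset (Fin n),
      ∑ᶠ x, cupProd f x Finset.univ = ∑ᶠ x, cupProd (s.piecewise f' f) x Finset.univ := by
    intro s
    induction s using Finset.induction_on with
    | empty => rw [Finset.piecewise_empty]
    | insert i s _ ih =>
      refine ih.trans (finsum_cupProd_congr_of_eq_off (hsep s) (hsep _) i fun j hj => ?_)
      rw [Finset.piecewise_insert, Function.update_of_ne hj]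
  simpa using H Finset.univ

/-- The labelling of the lattice by positivity of the coordinates. -/
def posLabel (j : Fin n) (x : Fin n → ℤ) : ZMod 2 := if 0 < x j then 1 else 0

theorem separating_posLabel {N : ℤ} (hN : 0 < N) : Separating N (posLabel (n := n)) :=
  fun _ _ => ⟨fun h => if_neg (by omega), fun h => if_pos (by omega)⟩

theorem list_prod_posLabel (l : List (Fin n)) (hl : l.Nodup) (x : Fin n → ℤ) :
    (l.map fun j => cupD (posLabel j)).prod one x l.toFinset =
      if ∀ j ∈ l, x j = 0 then 1 else 0 := by
  induction l generalizing x with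
  | nil => simp [one]
  | cons j l ih =>
    rw [List.nodup_cons] at hl
    rw [List.map_cons, List.prod_cons, Module.End.mul_apply, cupD_apply,
      Finset.sum_eq_single j]
    · have he : (j :: l).toFinset.erase j = l.toFinset := by
        rw [List.toFinset_cons, Finset.erase_insert (by simpa using hl.1)]
      rw [he, ih hl.2]
      have hx : (∀ i ∈ l, (x + Pi.single j 1 : Fin n → ℤ) i = 0) ↔ ∀ i ∈ l, x i = 0 :=
        forall₂_congr fun i hi => by
          rw [Pi.add_apply, Pi.single_eq_of_ne (by rintro rfl; exact hl.1 hi), add_zero]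
      simp only [hx, List.forall_mem_cons]
      simp only [posLabel, Pi.add_apply, Pi.single_eq_same]
      rcases lt_trichotomy (x j) 0 with h | h | h
      · rw [if_neg (by omega), if_neg (by omega), add_zero, zero_mul, if_neg fun h' => h.ne h'.1]
      · simp [h]
      · rw [if_pos (by omega), if_pos (by omega), CharTwo.add_self_eq_zero, zero_mul,
          if_neg fun h' => h.ne' h'.1]
    · intro d _ hd
      rw [posLabel, posLabel, Pi.add_apply, Pi.single_eq_of_ne hd.symm, add_zero,
        CharTwo.add_self_eq_zero, zero_mul]
    · intro h
      simp at h

theorem finsum_cupProd_posLabel :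
    ∑ᶠ x, cupProd (posLabel (n := n)) x Finset.univ = 1 := by
  have h : ∀ x, cupProd (posLabel (n := n)) x Finset.univ = if x = 0 then 1 else 0 := by
    intro x
    have := list_prod_posLabel (List.finRange n) (List.nodup_finRange n) x
    rw [List.toFinset_finRange] at this
    rw [cupProd, this]
    simp [funext_iff]
  simp only [h]
  rw [finsum_eq_single _ 0 fun x hx => if_neg hx, if_pos rfl]

/-- A discrete Poincaré–Miranda theorem: some unit cube of the lattice carries both labels in
each direction. -/
theorem exists_cube_of_separating {N : ℤ} (hN : 0 < N)
    {f : Fin n → (Fin n → ℤ) → ZMod 2} (hf : Separating N f) :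
    ∃ x : Fin n → ℤ, ∀ j, ∀ c : ZMod 2, ∃ y : Fin n → ℤ,
      (∀ d, x d ≤ y d ∧ y d ≤ x d + 1) ∧ f j y ≠ c := by
  have h1 : ∑ᶠ x, cupProd f x Finset.univ ≠ 0 := by
    rw [finsum_cupProd_congr hf (separating_posLabel hN), finsum_cupProd_posLabel]
    exact one_ne_zero
  obtain ⟨x, hx⟩ : ∃ x, cupProd f x Finset.univ ≠ 0 := by
    by_contra! h
    exact h1 (by simp [h])
  refine ⟨x, fun j c => ?_⟩
  by_contra! h
  exact hx (vanishOn_list_prod (moveClosed_cube x) (List.mem_finRange j)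
    (fun y _ hy => h y hy.1) _ x Finset.univ
    ⟨fun d => ⟨le_rfl, (lt_add_one _).le⟩, fun _ _ => rfl⟩)

end CubicalCochain

/-- The lattice point `x / N`, clamped to the unit cube. -/
noncomputable def clampedLattice {n : ℕ} (N : ℕ) (x : Fin n → ℤ) : Fin n → unitInterval :=
  fun d => Set.projIcc 0 1 zero_le_one ((x d : ℝ) / N)

theorem dist_clampedLattice_le {n N : ℕ} {x y : Fin n → ℤ}
    (h : ∀ d, x d ≤ y d ∧ y d ≤ x d + 1) :
    dist (clampedLattice N y) (clampedLattice N x) ≤ 1 / N := by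
  refine (dist_pi_le_iff (by positivity)).2 fun d => ?_
  refine (LipschitzWith.projIcc (zero_le_one' ℝ)).dist_le_mul _ _ |>.trans ?_
  have h1 : (x d : ℝ) ≤ y d := by exact_mod_cast (h d).1
  have h2 : (y d : ℝ) ≤ x d + 1 := by exact_mod_cast (h d).2
  rw [NNReal.coe_one, one_mul, Real.dist_eq, ← sub_div, abs_div, Nat.abs_cast]
  gcongr
  rw [abs_le]
  constructor <;> linarith

/-- An approximate Poincaré–Miranda theorem for self-maps of the cube preserving its faces. -/
theorem exists_dist_le_of_faces {n : ℕ} {g : (Fin n → unitInterval) → Fin n → unitInterval}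
    (hg : Continuous g) (h0 : ∀ x i, x i = 0 → g x i = 0) (h1 : ∀ x i, x i = 1 → g x i = 1)
    {y : Fin n → unitInterval} (hy1 : ∀ i, y i ≠ 1) {ε : ℝ}
    (hε : 0 < ε) : ∃ p, dist (g p) y ≤ ε := by
  obtain ⟨δ, hδ, H⟩ := Metric.uniformContinuous_iff.1
    (CompactSpace.uniformContinuous_of_continuous hg) ε hε
  obtain ⟨m, hm⟩ := exists_nat_one_div_lt hδ
  set N := m + 1 with hN
  have hNpos : (0 : ℝ) < N := by positivity
  let f : Fin n → (Fin n → ℤ) → ZMod 2 := fun j x =>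
    if y j < g (clampedLattice N x) j then 1 else 0
  have hf : CubicalCochain.Separating (N : ℤ) f := by
    refine fun j x => ⟨fun hx => if_neg ?_, fun hx => if_pos ?_⟩
    · rw [h0 _ j]
      · exact not_lt_bot
      · refine Set.projIcc_of_le_left _ (div_nonpos_of_nonpos_of_nonneg ?_ hNpos.le)
        exact_mod_cast hx
    · rw [h1 _ j]
      · exact lt_of_le_of_ne le_top (hy1 j)
      · refine Set.projIcc_of_right_le _ ((one_le_div hNpos).2 ?_)
        exact_mod_cast hx
  obtain ⟨x, hx⟩ := CubicalCochain.exists_cube_of_separating (by omega) hf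
  refine ⟨clampedLattice N x, (dist_pi_le_iff hε.le).2 fun j => ?_⟩
  have close : ∀ z : Fin n → ℤ, (∀ d, x d ≤ z d ∧ z d ≤ x d + 1) →
      |(g (clampedLattice N z) j : ℝ) - g (clampedLattice N x) j| < ε := fun z hz =>
    (dist_le_pi_dist _ _ j).trans_lt
      (H ((dist_clampedLattice_le hz).trans_lt (by rw [hN]; exact_mod_cast hm)))
  obtain ⟨z, hz, hfz⟩ := hx j 0
  obtain ⟨w, hw, hfw⟩ := hx j 1
  have hz' : (y j : ℝ) < g (clampedLattice N z) j := by
    by_contra h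
    exact hfz (if_neg h)
  have hw' : (g (clampedLattice N w) j : ℝ) ≤ y j := by
    by_contra h
    exact hfw (if_pos (not_le.1 h))
  have hcz := abs_lt.1 (close z hz)
  have hcw := abs_lt.1 (close w hw)
  rw [Subtype.dist_eq, Real.dist_eq, abs_le]
  constructor <;> linarith


/-- Every continuous map `g : [0,1]^n → [0,1]^n` whose restriction to the boundary
`∂[0,1]^n = ⋃_i (I_i^- ∪ I_i^+)` (the union of all faces `I_i^- = {x : x_i = 0}`,
`I_i^+ = {x : x_i = 1}`) is the identity is surjective: `g([0,1]^n) = [0,1]^n`. -/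
theorem surjective_of_boundary_id (n : ℕ)
    (g : (Fin n → unitInterval) → Fin n → unitInterval) (hg : Continuous g)
    (hbd : ∀ x ∈ ⋃ i : Fin n,
      ({x : Fin n → unitInterval | x i = 0} ∪ {x : Fin n → unitInterval | x i = 1}),
      g x = x) :
    g '' Set.univ = Set.univ := by
  have hface : ∀ x i, x i = 0 ∨ x i = 1 → g x = x := fun x i h =>
    hbd x (Set.mem_iUnion.2 ⟨i, h⟩)
  refine Set.eq_univ_of_forall fun y => ?_
  by_cases hy : ∃ i, y i = 0 ∨ y i = 1
  · obtain ⟨i, hi⟩ := hy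
    exact ⟨y, Set.mem_univ _, hface y i hi⟩
  push Not at hy
  have hclosed : IsClosed (g '' Set.univ) := (isCompact_univ.image hg).isClosed
  refine hclosed.closure_subset (Metric.mem_closure_iff.2 fun ε hε => ?_)
  obtain ⟨p, hp⟩ := exists_dist_le_of_faces hg
    (fun x i h => by rw [hface x i (Or.inl h), h])
    (fun x i h => by rw [hface x i (Or.inr h), h])
    (fun i => (hy i).2) (half_pos hε)
  exact ⟨g p, Set.mem_image_of_mem g (Set.mem_univ p), by rw [dist_comm]; linarith⟩
end
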